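/- arXiv:2202.04610 — 5 statements merged into one kernel-verified Lean document; each statement's English description precedes it below -/
import Mathlib

section
/- Let Θ = (θ₁,…,θ_m) with each θᵢ > 0, and let S₁, S₂ be m×m diagonal positive definite real matrices. Then for every u ∈ ℝ^m the following two inequalities hold: (i) ψ_Θ(u)ᵀ S₁ ψ_Θ(u) − Θᵀ S₁ Θ ≤ 0, and (ii) ψ_Θ(u)ᵀ S₂ (ψ_Θ(u) + u) ≤ 0. -/
open Matrix

/-- The sign function used by the uniform quantizer: `1` if `0 ≤ u`, `-1` otherwise. -/
noncomputable def qsign (u : ℝ) : ℝ := if 0 ≤ u then 1 else -1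

/-- The scalar uniform quantizer with quantization level `θ`:
`q_θ(u) = θ · sign(u) · ⌊|u|/θ⌋`. -/
noncomputable def uquant (θ u : ℝ) : ℝ := θ * qsign u * (⌊|u| / θ⌋ : ℤ)

/-- The vector quantization error `ψ_Θ(u) = q_Θ(u) − u`, where the vector uniform
quantizer `q_Θ` acts componentwise. -/
noncomputable def quantErr {m : ℕ} (Θ u : Fin m → ℝ) : Fin m → ℝ :=
  fun i => uquant (Θ i) (u i) - u i

theorem qsign_mul_self (u : ℝ) : qsign u * qsign u = 1 := by
  unfold qsign
  split_ifs <;> norm_num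

theorem qsign_mul_abs (u : ℝ) : qsign u * |u| = u := by
  unfold qsign
  split_ifs with h
  · rw [abs_of_nonneg h, one_mul]
  · rw [abs_of_neg (not_le.mp h), neg_one_mul, neg_neg]

theorem uquant_sub_self (θ u : ℝ) :
    uquant θ u - u = qsign u * (θ * (⌊|u| / θ⌋ : ℤ) - |u|) := by
  rw [mul_sub, qsign_mul_abs, uquant]
  ring

theorem mul_floor_abs_div_le {θ : ℝ} (hθ : 0 < θ) (u : ℝ) :
    θ * (⌊|u| / θ⌋ : ℤ) ≤ |u| :=
  (le_div_iff₀' hθ).mp (Int.floor_le _)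

theorem uquant_sub_self_mul_self_le {θ : ℝ} (hθ : 0 < θ) (u : ℝ) :
    (uquant θ u - u) * (uquant θ u - u) ≤ θ * θ := by
  have hlt : |u| < θ * ((⌊|u| / θ⌋ : ℤ) + 1) :=
    (div_lt_iff₀' hθ).mp (Int.lt_floor_add_one _)
  have hle := mul_floor_abs_div_le hθ u
  rw [uquant_sub_self, mul_mul_mul_comm, qsign_mul_self, one_mul]
  nlinarith

theorem uquant_sub_self_mul_uquant_nonpos {θ : ℝ} (hθ : 0 < θ) (u : ℝ) :
    (uquant θ u - u) * uquant θ u ≤ 0 := by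
  have hfloor : (0 : ℝ) ≤ (⌊|u| / θ⌋ : ℤ) := by
    exact_mod_cast Int.floor_nonneg.mpr (by positivity)
  have hq : uquant θ u = qsign u * (θ * (⌊|u| / θ⌋ : ℤ)) := by
    rw [uquant]
    ring
  rw [uquant_sub_self, hq, mul_mul_mul_comm, qsign_mul_self, one_mul]
  exact mul_nonpos_of_nonpos_of_nonneg (sub_nonpos.mpr (mul_floor_abs_div_le hθ u))
    (mul_nonneg hθ.le hfloor)

/-- Sector conditions for the vector quantization error: if each `θᵢ > 0` and
`S₁, S₂` are diagonal positive definite, then for every `u ∈ ℝ^m`: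
(i) `ψ_Θ(u)ᵀ S₁ ψ_Θ(u) − Θᵀ S₁ Θ ≤ 0` and (ii) `ψ_Θ(u)ᵀ S₂ (ψ_Θ(u) + u) ≤ 0`. -/
theorem quant_error_sector_conditions {m : ℕ} (Θ : Fin m → ℝ) (hΘ : ∀ i, 0 < Θ i)
    (S₁ S₂ : Matrix (Fin m) (Fin m) ℝ)
    (hS₁ : ∃ d : Fin m → ℝ, (∀ i, 0 < d i) ∧ S₁ = Matrix.diagonal d)
    (hS₂ : ∃ d : Fin m → ℝ, (∀ i, 0 < d i) ∧ S₂ = Matrix.diagonal d)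
    (u : Fin m → ℝ) :
    quantErr Θ u ⬝ᵥ S₁.mulVec (quantErr Θ u) - Θ ⬝ᵥ S₁.mulVec Θ ≤ 0 ∧
    quantErr Θ u ⬝ᵥ S₂.mulVec (quantErr Θ u + u) ≤ 0 := by
  obtain ⟨d₁, hd₁, rfl⟩ := hS₁
  obtain ⟨d₂, hd₂, rfl⟩ := hS₂
  simp only [dotProduct, mulVec_diagonal, Pi.add_apply, quantErr, sub_add_cancel, sub_nonpos,
    mul_left_comm _ (d₁ _), mul_left_comm _ (d₂ _)]
  exact ⟨Finset.sum_le_sum fun i _ =>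
      mul_le_mul_of_nonneg_left (uquant_sub_self_mul_self_le (hΘ i) (u i)) (hd₁ i).le,
    Finset.sum_nonpos fun i _ => mul_nonpos_of_nonneg_of_nonpos (hd₂ i).le
      (uquant_sub_self_mul_uquant_nonpos (hΘ i) (u i))⟩
end

section
/- Let g : ℝⁿ → ℝⁿ, let V : ℝⁿ → ℝ≥0 be locally bounded, let μ < 0 and c > 0, and suppose the sublevel set L_V(c) = {x : V(x) ≤ c} is compact. Assume (i) V(g(x)) ≤ e^μ · V(x) for every x in the closure of ℝⁿ \ L_V(c), and (ii) V(g(x)) ≤ c for every x ∈ L_V(c). Then L_V(c) is uniformly globally finite-time attractive for x⁺ = g(x): for every r ≥ 0 there exists N ∈ ℕ such that for every x₀ ∈ ℝⁿ with dist(x₀, L_V(c)) ≤ r and every j ≥ N, the j-th iterate g^[j](x₀) ∈ L_V(c). -/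
/-- If `V` contracts by the factor `a` outside its `c`-sublevel set and that set is forward
invariant, then along every iterate either `V ≤ c` or `V` has decayed geometrically. -/
theorem iterate_le_or_le_pow_mul {X : Type*} (g : X → X) (V : X → ℝ) {a c : ℝ} (ha : 0 ≤ a)
    (hdecay : ∀ x, c < V x → V (g x) ≤ a * V x) (hinv : ∀ x, V x ≤ c → V (g x) ≤ c)
    (x : X) (j : ℕ) : V (g^[j] x) ≤ c ∨ V (g^[j] x) ≤ a ^ j * V x := by
  induction j with
  | zero => simp
  | succ j ih =>
    rw [Function.iterate_succ_apply']
    rcases le_or_gt (V (g^[j] x)) c with h | h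
    · exact Or.inl (hinv _ h)
    · right
      calc V (g (g^[j] x)) ≤ a * V (g^[j] x) := hdecay _ h
        _ ≤ a * (a ^ j * V x) := mul_le_mul_of_nonneg_left (ih.resolve_left h.not_ge) ha
        _ = a ^ (j + 1) * V x := by ring

/-- A uniform bound on `V` yields a uniform time after which the iterates stay in the sublevel
set. -/
theorem exists_forall_iterate_le {X : Type*} (g : X → X) (V : X → ℝ) {a c : ℝ} (ha : 0 ≤ a)
    (ha1 : a < 1) (hc : 0 < c) (hdecay : ∀ x, c < V x → V (g x) ≤ a * V x)
    (hinv : ∀ x, V x ≤ c → V (g x) ≤ c) (C : ℝ) :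
    ∃ N : ℕ, ∀ x, V x ≤ C → ∀ j ≥ N, V (g^[j] x) ≤ c := by
  have hlim : Filter.Tendsto (fun j : ℕ => a ^ j * C) Filter.atTop (nhds 0) := by
    simpa using (tendsto_pow_atTop_nhds_zero_of_lt_one ha ha1).mul_const C
  obtain ⟨N, hN⟩ := Filter.eventually_atTop.1 (hlim.eventually_le_const hc)
  refine ⟨N, fun x hx j hj => ?_⟩
  rcases iterate_le_or_le_pow_mul g V ha hdecay hinv x j with h | h
  · exact h
  · exact h.trans ((mul_le_mul_of_nonneg_left hx (pow_nonneg ha j)).trans (hN j hj))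


/-- Lyapunov-type sufficient condition for uniform global finite-time attractivity
of a compact sublevel set: if `V ≥ 0` is locally bounded, `L_V(c)` is compact,
`V(g(x)) ≤ e^μ V(x)` (with `μ < 0`) on the closure of the complement of `L_V(c)`,
and `V(g(x)) ≤ c` on `L_V(c)`, then `L_V(c)` is uniformly globally finite-time
attractive for `x⁺ = g(x)`. -/
theorem sublevel_set_UGFTA {n : ℕ}
    (g : EuclideanSpace ℝ (Fin n) → EuclideanSpace ℝ (Fin n))
    (V : EuclideanSpace ℝ (Fin n) → ℝ) (hV0 : ∀ x, 0 ≤ V x)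
    (hVloc : ∀ K : Set (EuclideanSpace ℝ (Fin n)), IsCompact K → ∃ C : ℝ, ∀ x ∈ K, V x ≤ C)
    (μ : ℝ) (hμ : μ < 0) (c : ℝ) (hc : 0 < c)
    (hcomp : IsCompact {x : EuclideanSpace ℝ (Fin n) | V x ≤ c})
    (hdecay : ∀ x ∈ closure {x : EuclideanSpace ℝ (Fin n) | c < V x},
      V (g x) ≤ Real.exp μ * V x)
    (hinv : ∀ x : EuclideanSpace ℝ (Fin n), V x ≤ c → V (g x) ≤ c) :
    ∀ r : ℝ, 0 ≤ r → ∃ N : ℕ, ∀ x₀ : EuclideanSpace ℝ (Fin n),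
      Metric.infDist x₀ {x | V x ≤ c} ≤ r →
      ∀ j ≥ N, g^[j] x₀ ∈ {x | V x ≤ c} := by
  have hreach := exists_forall_iterate_le g V (Real.exp_nonneg μ) (Real.exp_lt_one_iff.2 hμ) hc
    (fun x hx => hdecay x (subset_closure hx)) hinv
  have hne : {x | V x ≤ c}.Nonempty := by
    obtain ⟨N, hN⟩ := hreach (V 0)
    exact ⟨_, hN 0 le_rfl N le_rfl⟩
  intro r hr
  obtain ⟨C, hC⟩ := hVloc _ (hcomp.cthickening (r := r))
  obtain ⟨N, hN⟩ := hreach C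
  refine ⟨N, fun x₀ hx₀ j hj => hN x₀ (hC x₀ ?_) j hj⟩
  rw [Metric.mem_cthickening_iff]
  exact (ENNReal.le_ofReal_iff_toReal_le (Metric.infEDist_ne_top hne) hr).2 hx₀
end

section
/- Let g : ℝⁿ → ℝⁿ, V : ℝⁿ → ℝ≥0, μ < 0 and c > 0, and assume V(g(y)) ≤ e^μ · V(y) for every y with V(y) > c. Then for every x ∈ ℝⁿ with V(x) > c there exists j ∈ ℕ with j ≤ ⌈(1/μ)·ln(c/V(x))⌉ such that V(g^[j](x)) ≤ c. In particular every trajectory of x⁺ = g(x) reaches the sublevel set L_V(c) = {x : V(x) ≤ c} in finite time bounded by ⌈(1/μ)·ln(c/V(x₀))⌉. -/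
/-- As long as a trajectory has stayed outside the sublevel set, `V` has decayed geometrically. -/
theorem iterate_le_exp_mul_of_forall_lt {α : Type*} {g : α → α} {V : α → ℝ} {μ c : ℝ}
    (hdecay : ∀ y, c < V y → V (g y) ≤ Real.exp μ * V y) {x : α} :
    ∀ k : ℕ, (∀ j < k, c < V (g^[j] x)) → V (g^[k] x) ≤ Real.exp (μ * k) * V x
  | 0, _ => by simp
  | k + 1, h => by
    have ih := iterate_le_exp_mul_of_forall_lt hdecay k fun j hj => h j (by omega)
    rw [Function.iterate_succ_apply']
    calc V (g (g^[k] x)) ≤ Real.exp μ * V (g^[k] x) := hdecay _ (h k k.lt_succ_self)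
      _ ≤ Real.exp μ * (Real.exp (μ * k) * V x) := by gcongr
      _ = Real.exp (μ * (k + 1 : ℕ)) * V x := by
        rw [← mul_assoc, ← Real.exp_add]
        push_cast
        ring_nf

/-- Finite-time entry into the sublevel set `L_V(c)`: if `μ < 0`, `c > 0` and
`V(g(y)) ≤ e^μ V(y)` whenever `V(y) > c`, then from any `x` with `V(x) > c` the
trajectory reaches `L_V(c)` within `⌈(1/μ)·ln(c/V(x))⌉` steps. -/
theorem finite_time_entry {n : ℕ}
    (g : (Fin n → ℝ) → (Fin n → ℝ)) (V : (Fin n → ℝ) → ℝ) (hV0 : ∀ x, 0 ≤ V x)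
    (μ : ℝ) (hμ : μ < 0) (c : ℝ) (hc : 0 < c)
    (hdecay : ∀ y, c < V y → V (g y) ≤ Real.exp μ * V y)
    (x : Fin n → ℝ) (hx : c < V x) :
    ∃ j : ℕ, (j : ℤ) ≤ ⌈(1 / μ) * Real.log (c / V x)⌉ ∧ V (g^[j] x) ≤ c := by
  by_contra! h
  have hVx : 0 < V x := hc.trans hx
  have hlog : Real.log (c / V x) ≤ 0 :=
    Real.log_nonpos (by positivity) ((div_le_one hVx).2 hx.le)
  have hnonneg : 0 ≤ (1 / μ) * Real.log (c / V x) :=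
    mul_nonneg_of_nonpos_of_nonpos (one_div_nonpos.2 hμ.le) hlog
  obtain ⟨N, hN⟩ := Int.eq_ofNat_of_zero_le (Int.ceil_nonneg hnonneg)
  have hle : (1 / μ) * Real.log (c / V x) ≤ N := by
    have := Int.le_ceil ((1 / μ) * Real.log (c / V x))
    rw [hN] at this
    exact_mod_cast this
  have hexp : μ * N ≤ Real.log (c / V x) := by
    have := mul_le_mul_of_nonpos_left hle hμ.le
    rwa [← mul_assoc, mul_one_div_cancel hμ.ne, one_mul] at this
  have hdec := iterate_le_exp_mul_of_forall_lt hdecay (x := x) N fun j hj => h j (by omega)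
  refine (h N hN.ge).not_ge (hdec.trans ?_)
  rw [← le_div_iff₀ hVx]
  exact (Real.le_log_iff_exp_le (by positivity)).1 hexp
end

section
/- Let A ∈ ℝ^{n×n} and τ ∈ (0,1) be such that the spectral radius satisfies ρ(A) < √(1−τ). Then there exists a symmetric positive definite matrix Q ∈ ℝ^{n×n} such that (τ−1)Q + Aᵀ Q A is negative definite. -/
open Matrix

open scoped Matrix.Norms.L2Operator in
/-- By Gelfand's formula, if `ρ(A) < s`, some positive power of `A` contracts strictly by the
corresponding power of `s`. -/
theorem exists_norm_pow_lt_of_spectralRadius_lt {n : ℕ} (M : Matrix (Fin n) (Fin n) ℂ) {s : ℝ}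
    (hs : 0 ≤ s) (hM : spectralRadius ℂ M < ENNReal.ofReal s) :
    ∃ N : ℕ, 1 ≤ N ∧ ‖M ^ N‖ < s ^ N := by
  have : CompleteSpace (Matrix (Fin n) (Fin n) ℂ) := FiniteDimensional.complete ℂ _
  have hev := (spectrum.pow_norm_pow_one_div_tendsto_nhds_spectralRadius M).eventually_lt_const hM
  obtain ⟨N, hN, hN1⟩ := (hev.and (Filter.eventually_ge_atTop 1)).exists
  refine ⟨N, hN1, ?_⟩
  have h := (ENNReal.ofReal_lt_ofReal_iff_of_nonneg (by positivity)).1 hN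
  rw [one_div, Real.rpow_inv_lt_iff_of_pos (norm_nonneg _) hs (by exact_mod_cast hN1)] at h
  exact_mod_cast h

open scoped Matrix.Norms.L2Operator in
theorem dotProduct_mulVec_self_le_l2_opNorm_sq {n : ℕ} (B : Matrix (Fin n) (Fin n) ℝ)
    (x : Fin n → ℝ) :
    (B *ᵥ x) ⬝ᵥ (B *ᵥ x) ≤ ‖B.map Complex.ofReal‖ ^ 2 * (x ⬝ᵥ x) := by
  have norm_sq (y : Fin n → ℝ) :
      ‖WithLp.toLp 2 (fun i ↦ (y i : ℂ))‖ ^ 2 = y ⬝ᵥ y := by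
    rw [EuclideanSpace.norm_sq_eq]
    simp [dotProduct, sq]
  have hmul : (fun i ↦ ((B *ᵥ x) i : ℂ)) = B.map Complex.ofReal *ᵥ fun i ↦ (x i : ℂ) := by
    ext i
    simp [mulVec, dotProduct]
  have h := l2_opNorm_mulVec (B.map Complex.ofReal) (WithLp.toLp 2 fun i ↦ (x i : ℂ))
  rw [← norm_sq, ← norm_sq, hmul, ← mul_pow]
  exact pow_le_pow_left₀ (norm_nonneg _) h 2

open scoped Matrix.Norms.L2Operator in
theorem exists_pow_mulVec_dotProduct_self_lt {n : ℕ} (A : Matrix (Fin n) (Fin n) ℝ) {s : ℝ}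
    (hs : 0 ≤ s) (hA : spectralRadius ℂ (A.map Complex.ofReal) < ENNReal.ofReal s) :
    ∃ N : ℕ, 1 ≤ N ∧ ∀ x : Fin n → ℝ, x ≠ 0 →
      (A ^ N *ᵥ x) ⬝ᵥ (A ^ N *ᵥ x) < (s ^ 2) ^ N * (x ⬝ᵥ x) := by
  obtain ⟨N, hN, hlt⟩ := exists_norm_pow_lt_of_spectralRadius_lt _ hs hA
  refine ⟨N, hN, fun x hx ↦ ?_⟩
  have hmap : (A ^ N).map Complex.ofReal = A.map Complex.ofReal ^ N :=
    map_pow Complex.ofRealHom.mapMatrix A N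
  have hpos : 0 < x ⬝ᵥ x := by simpa using dotProduct_star_self_pos_iff.2 hx
  have hsq := pow_lt_pow_left₀ hlt (norm_nonneg _) two_ne_zero
  rw [← pow_mul, mul_comm N, pow_mul, ← hmap] at hsq
  exact (dotProduct_mulVec_self_le_l2_opNorm_sq (A ^ N) x).trans_lt
    (mul_lt_mul_of_pos_right hsq hpos)

/-- A telescoping solution of the Stein equation with right-hand side `cᴺ I - (Aᴺ)ᵀ Aᴺ`. -/
theorem exists_posDef_stein {n : ℕ} (A : Matrix (Fin n) (Fin n) ℝ) {c : ℝ} (hc : 0 < c)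
    {N : ℕ} (hN : 1 ≤ N) :
    ∃ Q : Matrix (Fin n) (Fin n) ℝ, Q.PosDef ∧
      c • Q - Aᵀ * Q * A = c ^ N • (1 : Matrix (Fin n) (Fin n) ℝ) - (A ^ N)ᵀ * A ^ N := by
  induction N, hN using Nat.le_induction with
  | base => exact ⟨1, PosDef.one, by simp⟩
  | succ N _ ih =>
    obtain ⟨Q, hQ, h⟩ := ih
    refine ⟨c • Q + (A ^ N)ᵀ * A ^ N, (hQ.smul hc).add_posSemidef ?_, ?_⟩
    · simpa using posSemidef_conjTranspose_mul_self (A ^ N)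
    · have hpow : (A ^ (N + 1))ᵀ * A ^ (N + 1) = Aᵀ * ((A ^ N)ᵀ * A ^ N) * A := by
        simp only [pow_succ, transpose_mul, Matrix.mul_assoc]
      rw [hpow, pow_succ', SemigroupAction.mul_smul, ← sub_add_cancel (c ^ N • (1 : Matrix _ _ ℝ))
        ((A ^ N)ᵀ * A ^ N), ← h]
      simp only [Matrix.mul_add, Matrix.add_mul, smul_add, smul_sub, Matrix.mul_smul, Matrix.smul_mul]
      abel

/-- Discrete-time Lyapunov inequality with decay rate: if the spectral radius of
`A` satisfies `ρ(A) < √(1−τ)` for some `τ ∈ (0,1)`, then there exists `Q ≻ 0`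
such that `(τ−1)Q + Aᵀ Q A ≺ 0`. -/
theorem lyapunov_inequality_from_spectral_radius {n : ℕ}
    (A : Matrix (Fin n) (Fin n) ℝ) (τ : ℝ) (hτ₀ : 0 < τ) (hτ₁ : τ < 1)
    (hρ : spectralRadius ℂ (A.map Complex.ofReal) < ENNReal.ofReal (Real.sqrt (1 - τ))) :
    ∃ Q : Matrix (Fin n) (Fin n) ℝ, Q.PosDef ∧ (-((τ - 1) • Q + Aᵀ * Q * A)).PosDef := by
  have hc : 0 < 1 - τ := sub_pos.2 hτ₁
  obtain ⟨N, hN, hlt⟩ := exists_pow_mulVec_dotProduct_self_lt A (Real.sqrt_nonneg _) hρ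
  rw [Real.sq_sqrt hc.le] at hlt
  obtain ⟨Q, hQ, hstein⟩ := exists_posDef_stein A hc hN
  refine ⟨Q, hQ, ?_⟩
  have hneg : -((τ - 1) • Q + Aᵀ * Q * A) = (1 - τ) • Q - Aᵀ * Q * A := by
    rw [← neg_sub 1 τ, neg_smul]
    abel
  rw [hneg, hstein]
  refine PosDef.of_dotProduct_mulVec_pos ?_ fun x hx ↦ ?_
  · simp [IsHermitian, transpose_mul]
  have hdot : x ⬝ᵥ (((A ^ N)ᵀ * A ^ N) *ᵥ x) = (A ^ N *ᵥ x) ⬝ᵥ (A ^ N *ᵥ x) := by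
    rw [← mulVec_mulVec, dotProduct_mulVec, vecMul_transpose]
  rw [star_trivial, sub_mulVec, dotProduct_sub, hdot, smul_mulVec, one_mulVec, dotProduct_smul,
    smul_eq_mul, sub_pos]
  exact hlt x hx
end

section
/- Let C be a convex subset of a finite-dimensional real normed vector space E, let Q be a map from an open neighborhood of C into the n×n real symmetric matrices that is (Fréchet) differentiable on that neighborhood and psd-concave on C, and let L : C → Sⁿ be any map. Then for all x₀, x ∈ C: if L(x) + Q(x₀) + DQ(x₀)(x − x₀) is negative definite, then L(x) + Q(x) is negative definite. (That is, feasible points of the linearized matrix-inequality constraint are feasible for the original constraint.) -/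
open Matrix

attribute [local instance] Matrix.normedAddCommGroup Matrix.normedSpace

/-- Feasibility of the linearized constraint implies feasibility of the original
constraint: if `Q` is differentiable and psd-concave on the convex set `C`, and
`L(x) + Q(x₀) + DQ(x₀)(x − x₀) ≺ 0` for some `x₀, x ∈ C`, then
`L(x) + Q(x) ≺ 0`. -/
theorem linearized_feasible_implies_feasible {E : Type*}
    [NormedAddCommGroup E] [NormedSpace ℝ E] [FiniteDimensional ℝ E]
    {n : ℕ} (C U : Set E) (hC : Convex ℝ C) (hU : IsOpen U) (hCU : C ⊆ U)
    (Q : E → Matrix (Fin n) (Fin n) ℝ) (hQsymm : ∀ x ∈ U, (Q x).IsSymm)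
    (L : E → Matrix (Fin n) (Fin n) ℝ) (hLsymm : ∀ x ∈ C, (L x).IsSymm)
    (DQ : E → E →L[ℝ] Matrix (Fin n) (Fin n) ℝ)
    (hdiff : ∀ x ∈ U, HasFDerivAt Q (DQ x) x)
    (hconc : ∀ x ∈ C, ∀ y ∈ C, ∀ t : ℝ, t ∈ Set.Icc (0 : ℝ) 1 →
      (Q (t • x + (1 - t) • y) - (t • Q x + (1 - t) • Q y)).PosSemidef) :
    ∀ x₀ ∈ C, ∀ x ∈ C,
      (-(L x + Q x₀ + DQ x₀ (x - x₀))).PosDef → (-(L x + Q x)).PosDef := by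
  intro x₀ hx₀ x hx h
  refine PosDef.of_dotProduct_mulVec_pos ?_ fun v hv => ?_
  · rw [IsHermitian, conjTranspose_eq_transpose_of_trivial]
    exact ((hLsymm x hx).add (hQsymm x (hCU hx))).neg
  let φ : Matrix (Fin n) (Fin n) ℝ →ₗ[ℝ] ℝ :=
    { toFun := fun A => star v ⬝ᵥ (A *ᵥ v)
      map_add' := fun A B => by rw [add_mulVec, dotProduct_add]
      map_smul' := fun c A => by rw [smul_mulVec, dotProduct_smul]; rfl }
  have hpos : 0 < φ (-(L x + Q x₀ + DQ x₀ (x - x₀))) := h.dotProduct_mulVec_pos hv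
  change 0 < φ (-(L x + Q x))
  have hline : HasDerivAt (fun t : ℝ => x₀ + t • (x - x₀)) (x - x₀) 0 := by
    simpa using ((hasDerivAt_id (0 : ℝ)).smul_const (x - x₀)).const_add x₀
  have hQ : HasFDerivAt Q (DQ x₀) (x₀ + (0 : ℝ) • (x - x₀)) := by
    simpa using hdiff x₀ (hCU hx₀)
  have hderiv : HasDerivAt (fun t : ℝ => φ (Q (x₀ + t • (x - x₀)))) (φ (DQ x₀ (x - x₀))) 0 :=
    φ.toContinuousLinearMap.hasFDerivAt.comp_hasDerivAt 0 (hQ.comp_hasDerivAt 0 hline)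
  have hle : φ (Q x) - φ (Q x₀) ≤ φ (DQ x₀ (x - x₀)) := by
    refine ge_of_tendsto hderiv.tendsto_slope_zero_right ?_
    filter_upwards [Ioc_mem_nhdsGT (zero_lt_one' ℝ)] with t ht
    have hc : 0 ≤ φ (Q (t • x + (1 - t) • x₀) - (t • Q x + (1 - t) • Q x₀)) :=
      (hconc x hx x₀ hx₀ t ⟨ht.1.le, ht.2⟩).dotProduct_mulVec_nonneg v
    have hpt : t • x + (1 - t) • x₀ = x₀ + t • (x - x₀) := by module
    rw [hpt] at hc
    simp only [map_sub, map_add, map_smul, smul_eq_mul] at hc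
    simp only [zero_add, zero_smul, add_zero, smul_eq_mul]
    rw [inv_mul_eq_div, le_div_iff₀ ht.1]
    linarith
  simp only [map_neg, map_add] at hpos ⊢
  linarith
end
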